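/- arXiv:1101.3808 — 4 statements merged into one kernel-verified Lean document; each statement's English description precedes it below -/
import Mathlib

section
/- For all integers l ≥ 1, s ≥ 0 and all i ∈ ℤ one has the expansion S^l_s(i) = Σ_{j=1}^{s+1} r(i + (s−j+1)(p−n)) · S^{l−1}_{s−j+1}(i + n). -/
variable {R : Type*} [CommRing R]

/-- `Spoly n p r l s i` is the discrete polynomial
`S^l_s(i) = Σ_{1 ≤ λ_l ≤ … ≤ λ_1 ≤ s+1} Π_{j=1}^{l} r(i + (p−n)λ_j + jn − p)`,
the sum ranging over weakly decreasing `l`-tuples `λ_1 ≥ … ≥ λ_l` in `{1, …, s+1}`.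
For `l = 0` this gives `S^0_s(i) = 1` for every `s ≥ -1`, as in the convention. -/
noncomputable def Spoly (n p : ℤ) (r : ℤ → R) (l : ℕ) (s i : ℤ) : R :=
  ∑ lam ∈ Finset.filter (fun lam : Fin l → ℤ => ∀ j k : Fin l, j ≤ k → lam k ≤ lam j)
      (Fintype.piFinset fun _ : Fin l => Finset.Icc (1 : ℤ) (s + 1)),
    ∏ j : Fin l, r (i + (p - n) * lam j + (((j : ℕ) : ℤ) + 1) * n - p)

/-- `Tpoly n p r l s i` is the discrete polynomial
`T^l_s(i) = Σ_{1 ≤ λ_1 < … < λ_l ≤ s+1} Π_{j=1}^{l} r(i + (p−n)λ_j + jn − p)`,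
the sum ranging over strictly increasing `l`-tuples in `{1, …, s+1}`.
For `l = 0` this gives `T^0_s(i) = 1` for every `s ≥ -1`, and for `l ≥ 1` and
`-1 ≤ s ≤ l-2` the sum is empty, so `T^l_s(i) = 0`, as in the convention. -/
noncomputable def Tpoly (n p : ℤ) (r : ℤ → R) (l : ℕ) (s i : ℤ) : R :=
  ∑ lam ∈ Finset.filter (fun lam : Fin l → ℤ => ∀ j k : Fin l, j < k → lam j < lam k)
      (Fintype.piFinset fun _ : Fin l => Finset.Icc (1 : ℤ) (s + 1)),
    ∏ j : Fin l, r (i + (p - n) * lam j + (((j : ℕ) : ℤ) + 1) * n - p)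

/-- Expansion of `S^{l+1}_s(i)` along the value of the largest entry `λ_1` of the tuple. -/
theorem Spoly_succ (n p : ℤ) (r : ℤ → R) (l : ℕ) (s i : ℤ) :
    Spoly n p r (l + 1) s i
      = ∑ m ∈ Finset.Icc (1 : ℤ) (s + 1),
          r (i + (m - 1) * (p - n)) * Spoly n p r l (m - 1) (i + n) := by
  simp only [Spoly, Finset.mul_sum, Finset.sum_sigma']
  refine Finset.sum_bij' (fun lam _ => ⟨lam 0, Fin.tail lam⟩)
    (fun x _ => Fin.cons x.1 x.2) ?_ ?_ ?_ ?_ ?_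
  · intro lam h
    simp only [Finset.mem_filter, Fintype.mem_piFinset, Finset.mem_Icc, Finset.mem_sigma,
      Fin.tail, sub_add_cancel] at h ⊢
    exact ⟨h.1 0, fun j => ⟨(h.1 j.succ).1, h.2 0 j.succ (Fin.zero_le _)⟩,
      fun j k hjk => h.2 _ _ (Fin.succ_le_succ_iff.mpr hjk)⟩
  · rintro ⟨m, mu⟩ h
    simp only [Finset.mem_filter, Fintype.mem_piFinset, Finset.mem_Icc, Finset.mem_sigma,
      sub_add_cancel] at h ⊢
    obtain ⟨hm, hmu, hanti⟩ := h
    refine ⟨Fin.cases hm fun j => ?_, Fin.cases (Fin.cases ?_ ?_) fun j => Fin.cases ?_ ?_⟩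
    · simpa using ⟨(hmu j).1, (hmu j).2.trans hm.2⟩
    · simp
    · intro k _
      simpa using (hmu k).2
    · intro h
      exact absurd h (by simp)
    · intro k hjk
      simpa using hanti j k (Fin.succ_le_succ_iff.mp hjk)
  · intro lam _
    exact Fin.cons_self_tail lam
  · rintro ⟨m, mu⟩ _
    simp
  · intro lam _
    rw [Fin.prod_univ_succ]
    congr 1
    · congr 1
      simp only [Fin.val_zero, Nat.cast_zero]
      ring
    · refine Finset.prod_congr rfl fun j _ => ?_
      congr 1
      simp only [Fin.val_succ, Fin.tail]
      push_cast
      ring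

/-- Identity (13) of the paper: for `l ≥ 1`, `s ≥ 0` and all `i ∈ ℤ`,
`S^l_s(i) = Σ_{j=1}^{s+1} r(i + (s-j+1)(p-n)) * S^{l-1}_{s-j+1}(i + n)`. -/
theorem Spoly_expansion_first (n p : ℤ) (hn : 1 ≤ n) (hp : n < p) (r : ℤ → R)
    (l : ℕ) (hl : 1 ≤ l) (s : ℤ) (hs : 0 ≤ s) (i : ℤ) :
    Spoly n p r l s i
      = ∑ j ∈ Finset.Icc (1 : ℤ) (s + 1),
          r (i + (s - j + 1) * (p - n)) * Spoly n p r (l - 1) (s - j + 1) (i + n) := by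
  obtain ⟨l, rfl⟩ := Nat.exists_eq_add_of_le' hl
  rw [Spoly_succ, Nat.add_sub_cancel]
  refine Finset.sum_bij' (fun m _ => s + 2 - m) (fun j _ => s + 2 - j) ?_ ?_ ?_ ?_ ?_
  · intro m hm
    rw [Finset.mem_Icc] at hm ⊢
    omega
  · intro j hj
    rw [Finset.mem_Icc] at hj ⊢
    omega
  · intro m _
    ring
  · intro j _
    ring
  · intro m _
    rw [show s - (s + 2 - m) + 1 = m - 1 by ring]
end

section
/- For all integers l ≥ 1, s ≥ 0 and all i ∈ ℤ one has the expansion S^l_s(i) = Σ_{j=1}^{s+1} r(i + (j−1)p − (j−l)n) · S^{l−1}_{s−j+1}(i + (j−1)(p−n)). -/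
variable {R : Type*} [CommRing R]

/-- Identity (15) of the paper: for `l ≥ 1`, `s ≥ 0` and all `i ∈ ℤ`,
`S^l_s(i) = Σ_{j=1}^{s+1} r(i + (j-1)p - (j-l)n) * S^{l-1}_{s-j+1}(i + (j-1)(p-n))`. -/
theorem Spoly_expansion_last (n p : ℤ) (hn : 1 ≤ n) (hp : n < p) (r : ℤ → R)
    (l : ℕ) (hl : 1 ≤ l) (s : ℤ) (hs : 0 ≤ s) (i : ℤ) :
    Spoly n p r l s i
      = ∑ j ∈ Finset.Icc (1 : ℤ) (s + 1),
          r (i + (j - 1) * p - (j - (l : ℤ)) * n)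
            * Spoly n p r (l - 1) (s - j + 1) (i + (j - 1) * (p - n)) := by
  obtain ⟨m, rfl⟩ : ∃ m, l = m + 1 := ⟨l - 1, by omega⟩
  simp only [Spoly, Finset.mul_sum]
  rw [Finset.sum_sigma']
  -- Split a tuple into its smallest entry `j` and the remaining entries shifted down by `j - 1`.
  refine Finset.sum_bij'
    (fun lam _ => ⟨lam (Fin.last m), fun k => lam k.castSucc - (lam (Fin.last m) - 1)⟩)
    (fun x _ => Fin.snoc (α := fun _ => ℤ) (fun k => x.2 k + (x.1 - 1)) x.1) ?_ ?_ ?_ ?_ ?_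
  · intro lam h
    simp only [Finset.mem_filter, Fintype.mem_piFinset, Finset.mem_Icc, Finset.mem_sigma] at h ⊢
    obtain ⟨hb, hd⟩ := h
    refine ⟨hb _, fun k => ?_, fun j k hjk => ?_⟩
    · have := hd k.castSucc (Fin.last m) (Fin.le_last _)
      have := hb k.castSucc
      omega
    · have := hd j.castSucc k.castSucc (Fin.castSucc_le_castSucc_iff.2 hjk)
      omega
  · rintro ⟨a, mu⟩ h
    simp only [Finset.mem_filter, Fintype.mem_piFinset, Finset.mem_Icc, Finset.mem_sigma] at h ⊢
    obtain ⟨ha, hb, hd⟩ := h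
    refine ⟨fun k => ?_, fun j k hjk => ?_⟩
    · induction k using Fin.lastCases with
      | last => simpa using ha
      | cast k =>
        have := hb k
        simp only [Fin.snoc_castSucc]
        omega
    · induction k using Fin.lastCases with
      | last =>
        induction j using Fin.lastCases with
        | last => exact le_rfl
        | cast j =>
          have := hb j
          simp only [Fin.snoc_castSucc, Fin.snoc_last]
          omega
      | cast k =>
        induction j using Fin.lastCases with
        | last => exact absurd hjk (not_le.2 (Fin.castSucc_lt_last k))
        | cast j =>
          have := hd j k (Fin.castSucc_le_castSucc_iff.1 hjk)
          simp only [Fin.snoc_castSucc]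
          omega
  · intro lam _
    funext k
    induction k using Fin.lastCases <;> simp
  · rintro ⟨a, mu⟩ _
    simp
  · intro lam _
    rw [Fin.prod_univ_castSucc, mul_comm]
    congr 1
    · congr 1
      simp only [Fin.val_last]
      push_cast
      ring
    · refine Finset.prod_congr rfl fun k _ => ?_
      congr 1
      simp only [Fin.val_castSucc]
      ring
end

section
/- For all integers l ≥ 1, s ≥ l − 1 and all i ∈ ℤ one has the expansion T^l_s(i) = Σ_{j=1}^{s−l+2} r(i + (s−j+1)p − (s−l−j+2)n) · T^{l−1}_{s−j}(i). -/
variable {R : Type*} [CommRing R]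

/-- A strictly increasing tuple of positive integers dominates `1, 2, 3, …` entrywise. -/
theorem succ_le_apply_of_strictMono {k : ℕ} {lam : Fin k → ℤ} (hlam : StrictMono lam)
    (hpos : ∀ j, 1 ≤ lam j) (j : Fin k) : ((j : ℕ) : ℤ) + 1 ≤ lam j := by
  obtain ⟨m, hm⟩ := j
  induction m with
  | zero => simpa using hpos ⟨0, hm⟩
  | succ m ih =>
    have hstep : lam ⟨m, by omega⟩ < lam ⟨m + 1, hm⟩ := hlam (by simp)
    have hprev := ih (by omega)
    push_cast at hprev ⊢
    omega

/-- Identity (19) of the paper: for `l ≥ 1`, `s ≥ l - 1` and all `i ∈ ℤ`,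
`T^l_s(i) = Σ_{j=1}^{s-l+2} r(i + (s-j+1)p - (s-l-j+2)n) * T^{l-1}_{s-j}(i)`. -/
theorem Tpoly_expansion_last (n p : ℤ) (hn : 1 ≤ n) (hp : n < p) (r : ℤ → R)
    (l : ℕ) (hl : 1 ≤ l) (s : ℤ) (hs : (l : ℤ) - 1 ≤ s) (i : ℤ) :
    Tpoly n p r l s i
      = ∑ j ∈ Finset.Icc (1 : ℤ) (s - (l : ℤ) + 2),
          r (i + (s - j + 1) * p - (s - (l : ℤ) - j + 2) * n)
            * Tpoly n p r (l - 1) (s - j) i := by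
  obtain ⟨k, rfl⟩ : ∃ k, l = k + 1 := ⟨l - 1, by omega⟩
  rw [Nat.add_sub_cancel]
  simp only [Tpoly, Finset.mul_sum]
  rw [Finset.sum_sigma']
  refine Finset.sum_bij' (fun lam _ => ⟨s + 2 - lam (Fin.last k), Fin.init lam⟩)
    (fun x _ => Fin.snoc (α := fun _ => ℤ) x.2 (s + 2 - x.1)) ?_ ?_ ?_ ?_ ?_
  · intro lam hlam
    simp only [Finset.mem_filter, Fintype.mem_piFinset, Finset.mem_Icc] at hlam
    obtain ⟨hbd, hmono⟩ := hlam
    have hlast := succ_le_apply_of_strictMono (fun a b => hmono a b) (fun j => (hbd j).1)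
      (Fin.last k)
    have hle := (hbd (Fin.last k)).2
    simp only [Fin.val_last] at hlast
    simp only [Finset.mem_sigma, Finset.mem_filter, Fintype.mem_piFinset, Finset.mem_Icc,
      Fin.init]
    push_cast
    refine ⟨⟨by omega, by omega⟩, fun j => ⟨(hbd _).1, ?_⟩, fun a b hab => hmono _ _ ?_⟩
    · have := hmono _ _ (Fin.castSucc_lt_last j)
      omega
    · simpa using hab
  · rintro ⟨j, lam⟩ hx
    simp only [Finset.mem_sigma, Finset.mem_filter, Fintype.mem_piFinset, Finset.mem_Icc] at hx
    obtain ⟨⟨hj, hjs⟩, hbd, hmono⟩ := hx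
    push_cast at hjs
    simp only [Finset.mem_filter, Fintype.mem_piFinset, Finset.mem_Icc]
    refine ⟨fun a => ?_, fun a b hab => ?_⟩
    · induction a using Fin.lastCases with
      | last =>
        rw [Fin.snoc_last]
        omega
      | cast a =>
        rw [Fin.snoc_castSucc]
        have := hbd a
        omega
    · induction a using Fin.lastCases with
      | last => exact absurd hab (Fin.le_last b).not_gt
      | cast a =>
        induction b using Fin.lastCases with
        | last =>
          rw [Fin.snoc_last, Fin.snoc_castSucc]
          have := hbd a
          omega
        | cast b =>
          rw [Fin.snoc_castSucc, Fin.snoc_castSucc]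
          exact hmono a b (by simpa using hab)
  · intro lam _
    simp
  · rintro ⟨j, lam⟩ _
    simp
  · intro lam _
    rw [Fin.prod_univ_castSucc, mul_comm]
    congr 2
    simp only [Fin.val_last]
    push_cast
    ring
end

section
/- For all integers l ≥ 1, s ≥ 0 and all i ∈ ℤ the alternating relation S^l_s(i) + Σ_{j=1}^{l−1} (−1)^j S^{l−j}_s(i) T^j_s(i + (l−j)n) + (−1)^l T^l_s(i) = 0 holds. -/
variable {R : Type*} [CommRing R]

/-- The sum of `∏ j, f j (w j)` over the words `w` of length `l` in the alphabet `K` that are weakly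
decreasing on the positions before `a` and strictly increasing on the positions from `b` on. -/
def decIncSum {α : Type*} [LinearOrder α] (K : Finset α) (f : ℕ → α → R) (l a b : ℕ) : R :=
  ∑ w ∈ Finset.filter (fun w : Fin l → α =>
      (∀ j k : Fin l, j ≤ k → (k : ℕ) < a → w k ≤ w j) ∧
        ∀ j k : Fin l, j < k → b ≤ (j : ℕ) → w j < w k)
      (Fintype.piFinset fun _ => K),
    ∏ j : Fin l, f j (w j)

/-- Concatenating a weakly decreasing word with a strictly increasing one. -/
lemma sum_antitone_mul_sum_strictMono {α : Type*} [LinearOrder α] (K : Finset α)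
    (f : ℕ → α → R) (a b : ℕ) :
    (∑ u ∈ Finset.filter (fun u : Fin a → α => ∀ j k : Fin a, j ≤ k → u k ≤ u j)
        (Fintype.piFinset fun _ => K), ∏ j : Fin a, f j (u j)) *
      (∑ v ∈ Finset.filter (fun v : Fin b → α => ∀ j k : Fin b, j < k → v j < v k)
        (Fintype.piFinset fun _ => K), ∏ j : Fin b, f (a + j) (v j)) =
      decIncSum K f (a + b) a a := by
  rw [Finset.sum_mul_sum, ← Finset.sum_product', decIncSum]
  refine Finset.sum_nbij' (fun q => Fin.append q.1 q.2)
    (fun w => (fun j => w (Fin.castAdd b j), fun j => w (Fin.natAdd a j))) ?_ ?_ ?_ ?_ ?_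
  · rintro ⟨u, v⟩ h
    simp only [Finset.mem_product, Finset.mem_filter, Fintype.mem_piFinset] at h ⊢
    obtain ⟨⟨hu, hu'⟩, hv, hv'⟩ := h
    refine ⟨fun j => ?_, fun j k => ?_, fun j k => ?_⟩
    · refine Fin.addCases (fun j => ?_) (fun j => ?_) j
      · simpa using hu j
      · simpa using hv j
    · refine Fin.addCases (fun j => ?_) (fun j => ?_) j <;>
        refine Fin.addCases (fun k => ?_) (fun k => ?_) k <;> intro hjk hk
      · simpa using hu' j k hjk
      · simp at hk
      · have := k.isLt
        simp only [Fin.le_def, Fin.val_natAdd, Fin.val_castAdd] at hjk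
        omega
      · simp at hk
    · refine Fin.addCases (fun j => ?_) (fun j => ?_) j <;>
        refine Fin.addCases (fun k => ?_) (fun k => ?_) k <;> intro hjk hj
      · have := j.isLt
        simp at hj
        omega
      · have := j.isLt
        simp at hj
        omega
      · have := k.isLt
        simp only [Fin.lt_def, Fin.val_natAdd, Fin.val_castAdd] at hjk
        omega
      · simpa using hv' j k (by simpa using hjk)
  · intro w h
    simp only [Finset.mem_product, Finset.mem_filter, Fintype.mem_piFinset] at h ⊢
    obtain ⟨hw, hd, hi⟩ := h
    exact ⟨⟨fun j => hw _, fun j k hjk => hd _ _ hjk (by simp)⟩,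
      fun j => hw _, fun j k hjk => hi _ _ (by simpa using hjk) (by simp)⟩
  · rintro ⟨u, v⟩ -
    simp
  · intro w _
    exact Fin.append_castAdd_natAdd
  · rintro ⟨u, v⟩ -
    simp [Fin.prod_univ_add]

lemma decIncSum_self_eq_add {α : Type*} [LinearOrder α] (K : Finset α) (f : ℕ → α → R)
    {l m : ℕ} (hm : m + 1 < l) :
    decIncSum K f l (m + 1) (m + 1) =
      decIncSum K f l (m + 1) m + decIncSum K f l (m + 2) (m + 1) := by
  unfold decIncSum
  rw [← Finset.sum_filter_add_sum_filter_not _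
    (fun w : Fin l → α => w ⟨m, Nat.lt_of_succ_lt hm⟩ < w ⟨m + 1, hm⟩)]
  congr 1
  · refine Finset.sum_congr ?_ fun _ _ => rfl
    ext w
    simp only [Finset.mem_filter]
    constructor
    · rintro ⟨⟨hK, hd, hi⟩, hlt⟩
      refine ⟨hK, hd, fun j k hjk hj => ?_⟩
      rcases Nat.eq_or_lt_of_le hj with hj | hj
      · obtain rfl : j = ⟨m, Nat.lt_of_succ_lt hm⟩ := Fin.ext hj.symm
        rcases Nat.eq_or_lt_of_le (Fin.lt_def.1 hjk) with hk | hk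
        · obtain rfl : k = ⟨m + 1, hm⟩ := Fin.ext hk.symm
          exact hlt
        · exact hlt.trans (hi _ _ (Fin.lt_def.2 hk) le_rfl)
      · exact hi j k hjk hj
    · rintro ⟨hK, hd, hi⟩
      exact ⟨⟨hK, hd, fun j k hjk hj => hi j k hjk (by omega)⟩,
        hi _ _ (Fin.lt_def.2 (Nat.lt_succ_self m)) le_rfl⟩
  · refine Finset.sum_congr ?_ fun _ _ => rfl
    ext w
    simp only [Finset.mem_filter, not_lt]
    constructor
    · rintro ⟨⟨hK, hd, hi⟩, hle⟩
      refine ⟨hK, fun j k hjk hk => ?_, hi⟩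
      rcases Nat.eq_or_lt_of_le (Nat.le_of_lt_succ hk) with hk | hk
      · obtain rfl : k = ⟨m + 1, hm⟩ := Fin.ext hk
        rcases Nat.eq_or_lt_of_le (Fin.le_def.1 hjk) with hj | hj
        · obtain rfl : j = ⟨m + 1, hm⟩ := Fin.ext hj
          exact le_rfl
        · exact hle.trans (hd _ _ (Fin.le_def.2 (Nat.le_of_lt_succ hj)) (Nat.lt_succ_self m))
      · exact hd j k hjk hk
    · rintro ⟨hK, hd, hi⟩
      exact ⟨⟨hK, fun j k hjk hk => hd j k hjk (by omega), hi⟩,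
        hd _ _ (Fin.le_def.2 (Nat.le_succ m)) (Nat.lt_succ_self _)⟩

lemma decIncSum_length {α : Type*} [LinearOrder α] (K : Finset α) (f : ℕ → α → R) (l : ℕ) :
    decIncSum K f (l + 1) (l + 1) (l + 1) = decIncSum K f (l + 1) (l + 1) l := by
  unfold decIncSum
  refine Finset.sum_congr (Finset.filter_congr fun w _ => and_congr_right fun _ => ?_)
    fun _ _ => rfl
  constructor <;> intro _ j k hjk hj <;> rw [Fin.lt_def] at hjk <;> omega

lemma decIncSum_zero {α : Type*} [LinearOrder α] (K : Finset α) (f : ℕ → α → R) (l : ℕ) :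
    decIncSum K f l 0 0 = decIncSum K f l 1 0 := by
  unfold decIncSum
  refine Finset.sum_congr (Finset.filter_congr fun w _ => and_congr_left fun _ => ?_)
    fun _ _ => rfl
  refine ⟨fun _ j k hjk hk => ?_, fun _ j k _ hk => by omega⟩
  rw [show j = k by ext; rw [Fin.le_def] at hjk; omega]

lemma sum_range_neg_one_pow_mul_decIncSum {α : Type*} [LinearOrder α] (K : Finset α)
    (f : ℕ → α → R) (l k : ℕ) (hk : k ≤ l) :
    ∑ j ∈ Finset.range (k + 1),
        (-1 : R) ^ j * decIncSum K f (l + 1) (l + 1 - j) (l + 1 - j) =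
      (-1) ^ k * decIncSum K f (l + 1) (l - k + 1) (l - k) := by
  induction k with
  | zero => simp [decIncSum_length]
  | succ k ih =>
    obtain ⟨m, rfl⟩ := Nat.exists_eq_add_of_le' hk
    rw [Finset.sum_range_succ, ih (by omega),
      show m + (k + 1) + 1 - (k + 1) = m + 1 by omega,
      show m + (k + 1) - k = m + 1 by omega, show m + (k + 1) - (k + 1) = m by omega,
      decIncSum_self_eq_add K f (by omega)]
    ring

/-- The alternating sum over all ways to split words into a weakly decreasing prefix and a strictly
increasing suffix vanishes. -/
lemma alternating_sum_decIncSum {α : Type*} [LinearOrder α] (K : Finset α)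
    (f : ℕ → α → R) (l : ℕ) :
    ∑ j ∈ Finset.range (l + 2),
        (-1 : R) ^ j * decIncSum K f (l + 1) (l + 1 - j) (l + 1 - j) = 0 := by
  rw [Finset.sum_range_succ, sum_range_neg_one_pow_mul_decIncSum K f l l le_rfl]
  simp only [Nat.sub_self, zero_add, decIncSum_zero]
  ring

lemma Spoly_mul_Tpoly (n p : ℤ) (r : ℤ → R) (a b : ℕ) (s i : ℤ) :
    Spoly n p r a s i * Tpoly n p r b s (i + (a : ℤ) * n) =
      decIncSum (Finset.Icc 1 (s + 1))
        (fun j x => r (i + (p - n) * x + ((j : ℤ) + 1) * n - p)) (a + b) a a := by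
  rw [← sum_antitone_mul_sum_strictMono, Spoly, Tpoly]
  congr 1
  refine Finset.sum_congr rfl fun w _ => Finset.prod_congr rfl fun j _ => ?_
  congr 1
  push_cast
  ring

lemma Spoly_zero (n p : ℤ) (r : ℤ → R) (s i : ℤ) : Spoly n p r 0 s i = 1 := by
  simp [Spoly]

lemma Tpoly_zero (n p : ℤ) (r : ℤ → R) (s i : ℤ) : Tpoly n p r 0 s i = 1 := by
  simp [Tpoly]

/-- First alternating relation of the paper: for `l ≥ 1`, `s ≥ 0` and all `i ∈ ℤ`,
`S^l_s(i) + Σ_{j=1}^{l-1} (-1)^j S^{l-j}_s(i) T^j_s(i + (l-j)n) + (-1)^l T^l_s(i) = 0`. -/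
theorem ST_alternating_first (n p : ℤ) (hn : 1 ≤ n) (hp : n < p) (r : ℤ → R)
    (l : ℕ) (hl : 1 ≤ l) (s : ℤ) (hs : 0 ≤ s) (i : ℤ) :
    Spoly n p r l s i
      + (∑ j ∈ Finset.Icc 1 (l - 1), (-1 : R) ^ j * Spoly n p r (l - j) s i
          * Tpoly n p r j s (i + ((l : ℤ) - (j : ℤ)) * n))
      + (-1 : R) ^ l * Tpoly n p r l s i = 0 := by
  obtain ⟨l, rfl⟩ := Nat.exists_eq_add_of_le' hl
  rw [← alternating_sum_decIncSum (Finset.Icc 1 (s + 1))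
    (fun j x => r (i + (p - n) * x + ((j : ℤ) + 1) * n - p)) l]
  have key : ∀ j ∈ Finset.range (l + 2),
      (-1 : R) ^ j * decIncSum (Finset.Icc 1 (s + 1))
        (fun j x => r (i + (p - n) * x + ((j : ℤ) + 1) * n - p)) (l + 1) (l + 1 - j) (l + 1 - j) =
      (-1 : R) ^ j * Spoly n p r (l + 1 - j) s i *
        Tpoly n p r j s (i + (((l + 1 : ℕ) : ℤ) - (j : ℤ)) * n) := by
    intro j hj
    have hj' : j ≤ l + 1 := Nat.le_of_lt_succ (Finset.mem_range.1 hj)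
    rw [mul_assoc, ← Nat.cast_sub hj', Spoly_mul_Tpoly, Nat.sub_add_cancel hj']
  rw [Finset.sum_congr rfl key, Finset.sum_range_succ, Finset.range_eq_Ico,
    Finset.sum_eq_sum_Ico_succ_bot (Nat.succ_pos l)]
  simp [Spoly_zero, Tpoly_zero, ← Finset.Ico_add_one_right_eq_Icc]
end
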